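/- Let μ and ν be radial Borel probability measures on ℝ³ such that μ({0}) = 0, ∫_{ℝ³} |x| dμ(x) < ∞ and ∫_{ℝ³} |x| dν(x) < ∞. Then Ψ_{μν} is locally Lipschitz on [0,∞)², its (almost everywhere defined) gradient satisfies |∇Ψ_{μν}(a,b)| ≤ C (a²b³ + a³b²) for a constant C, and Ψ_{μν} vanishes on the two axes {a = 0} ∪ {b = 0}. If moreover ν({0}) = 0, then Ψ_{μν} is C¹. -/

import Mathlib

open MeasureTheory ENNReal Set Metric Filter Real Topology
open scoped RealInnerProductSpace

noncomputable section

/-- Three-dimensional Euclidean space. -/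
abbrev E3 := EuclideanSpace ℝ (Fin 3)

/-- The Coulomb kernel `|x-y|⁻¹`, valued in `ℝ≥0∞` (equal to `∞` on the diagonal). -/
def coul (x y : E3) : ℝ≥0∞ := (ENNReal.ofReal ‖x - y‖)⁻¹

/-- The Coulomb energy `D(ν₁,ν₂) = (1/2)∬ |x-y|⁻¹ dν₁ dν₂`, valued in `ℝ≥0∞`. -/
def DD (ν₁ ν₂ : Measure E3) : ℝ≥0∞ := 2⁻¹ * ∫⁻ x, ∫⁻ y, coul x y ∂ν₂ ∂ν₁

/-- The real-valued Coulomb energy `D(ν₁,ν₂)`. -/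
def Dr (ν₁ ν₂ : Measure E3) : ℝ := (DD ν₁ ν₂).toReal

/-- A measure on `ℝ³` is radial if it is invariant under all linear isometries
(rotations about the origin). -/
def IsRadial (μ : Measure E3) : Prop := ∀ e : E3 ≃ₗᵢ[ℝ] E3, Measure.map e μ = μ

/-- `μ_{v,a}` : the measure `μ` dilated by `1/a` and recentered at `v`, i.e. the pushforward
of `μ` under `u ↦ v + u/a`. -/
def dilate (μ : Measure E3) (v : E3) (a : ℝ) : Measure E3 :=
  Measure.map (fun u => v + a⁻¹ • u) μ

/-- The first basis vector `e₁ = (1,0,0)`. -/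
def e1 : E3 := EuclideanSpace.single (0 : Fin 3) (1 : ℝ)

/-- `Φ_{μν}(a,b) = a³b³(1 - 2D(μ_{0,a}, ν_{e₁,b}))`, extended by `0` when `a = 0` or `b = 0`. -/
def Phi (μ ν : Measure E3) (a b : ℝ) : ℝ :=
  if 0 < a ∧ 0 < b then a ^ 3 * b ^ 3 * (1 - 2 * Dr (dilate μ 0 a) (dilate ν e1 b)) else 0

/-- `Ψ_{μν} = Φ_{μν} + Φ_{νμ} - Φ_{νν}`. -/
def Psi (μ ν : Measure E3) (a b : ℝ) : ℝ := Phi μ ν a b + Phi ν μ a b - Phi ν ν a b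

lemma aux_pol2 (φ : ℝ → ℝ≥0∞) (hφ : Measurable φ) :
    ∫⁻ p : ℝ × ℝ, φ (p.1 ^ 2 + p.2 ^ 2) =
      ENNReal.ofReal (2 * π) * ∫⁻ ρ in Ioi (0:ℝ), ENNReal.ofReal ρ * φ (ρ ^ 2) := by
  rw [← lintegral_comp_polarCoord_symm]
  have h1 : ∀ p : ℝ × ℝ, (polarCoord.symm p).1 ^ 2 + (polarCoord.symm p).2 ^ 2 = p.1 ^ 2 := by
    intro p
    simp only [polarCoord_symm_apply]
    nlinarith [Real.sin_sq_add_cos_sq p.2]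
  simp_rw [h1, smul_eq_mul]
  rw [polarCoord_target, Measure.volume_eq_prod, ← Measure.prod_restrict,
    lintegral_prod _ (by fun_prop)]
  simp only [lintegral_const, Measure.restrict_apply, MeasurableSet.univ, univ_inter,
    Real.volume_Ioo]
  rw [lintegral_mul_const _ (by fun_prop), mul_comm]
  congr 2
  ring

lemma aux_cyl (Φ : ℝ × ℝ → ℝ≥0∞) (hΦ : Measurable Φ) :
    ∫⁻ x : E3, Φ (x 0, (x 1) ^ 2 + (x 2) ^ 2) =
      ∫⁻ t : ℝ, ∫⁻ p : ℝ × ℝ, Φ (t, p.1 ^ 2 + p.2 ^ 2) := by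
  have h1 := (PiLp.volume_preserving_ofLp (Fin 3)).lintegral_comp
    (f := fun x : Fin 3 → ℝ => Φ (x 0, (x 1) ^ 2 + (x 2) ^ 2)) (by fun_prop)
  rw [h1]
  have h2 := (volume_preserving_piFinSuccAbove (fun _ : Fin 3 => ℝ) 0).lintegral_comp
    (f := fun q : ℝ × (Fin 2 → ℝ) => Φ (q.1, (q.2 0) ^ 2 + (q.2 1) ^ 2)) (by fun_prop)
  have h2' : ∫⁻ x : Fin 3 → ℝ, Φ (x 0, (x 1) ^ 2 + (x 2) ^ 2) =
     ∫⁻ q : ℝ × (Fin 2 → ℝ), Φ (q.1, (q.2 0) ^ 2 + (q.2 1) ^ 2) := by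
    rw [← h2]
    rfl
  rw [h2', Measure.volume_eq_prod, lintegral_prod _ (by fun_prop)]
  congr 1
  ext t
  exact (volume_preserving_finTwoArrow ℝ).lintegral_comp
    (f := fun p : ℝ × ℝ => Φ (t, p.1 ^ 2 + p.2 ^ 2)) (by fun_prop)

lemma aux_cos (k : ℝ → ℝ≥0∞) :
    ∫⁻ z in Icc (-1:ℝ) 1, k z =
      ∫⁻ θ in Icc 0 π, ENNReal.ofReal (Real.sin θ) * k (Real.cos θ) := by
  rw [← Real.bijOn_cos.image_eq, lintegral_image_eq_lintegral_abs_deriv_mul measurableSet_Icc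
    (fun x _ => (Real.hasDerivAt_cos x).hasDerivWithinAt) Real.bijOn_cos.injOn]
  apply setLIntegral_congr_fun measurableSet_Icc
  intro θ hθ
  simp only
  rw [abs_neg, abs_of_nonneg (Real.sin_nonneg_of_mem_Icc hθ)]

lemma aux_half (k : ℝ → ℝ≥0∞) :
    ∫⁻ θ in Ioo (-π) π, ENNReal.ofReal (Real.sin θ) * k (Real.cos θ) =
    ∫⁻ z in Icc (-1:ℝ) 1, k z := by
  rw [aux_cos, setLIntegral_congr (Ioo_ae_eq_Icc (a := 0) (b := π)).symm]
  have hsub : Ioo (-π) π = Ioc (-π) 0 ∪ Ioo 0 π := by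
    rw [Ioc_union_Ioo_eq_Ioo (by linarith [Real.pi_pos]) Real.pi_pos]
  rw [hsub, lintegral_union measurableSet_Ioo (by
    rw [Set.disjoint_left]; intro x hx hx2; exact absurd hx.2 (not_le.2 hx2.1))]
  rw [setLIntegral_congr_fun (g := fun _ => 0) measurableSet_Ioc]
  · simp
  · intro θ hθ
    simp only
    rw [ENNReal.ofReal_of_nonpos (Real.sin_nonpos_of_nonpos_of_neg_pi_le hθ.2 hθ.1.le), zero_mul]

lemma aux_arch0 : ∃ C0 : ℝ≥0∞, ∀ k : ℝ → ℝ≥0∞, Measurable k →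
    ∫⁻ x in ball (0 : E3) 1, k (x 0 / ‖x‖) = C0 * ∫⁻ z in Icc (-1:ℝ) 1, k z := by
  refine ⟨ENNReal.ofReal (2 * π) * ∫⁻ R in Ioi (0:ℝ), ENNReal.ofReal R *
    (ENNReal.ofReal R * (Iio (1:ℝ)).indicator 1 R), fun k hk => ?_⟩
  have hm1 : Measurable ((Iio (1:ℝ)).indicator (1 : ℝ → ℝ≥0∞)) :=
    measurable_one.indicator measurableSet_Iio
  set Φ : ℝ × ℝ → ℝ≥0∞ := fun q =>
    (Iio (1:ℝ)).indicator 1 (√(q.1 ^ 2 + q.2)) * k (q.1 / √(q.1 ^ 2 + q.2)) with hΦdef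
  have hΦ : Measurable Φ := by fun_prop
  have e0 : ∀ x : E3, ‖x‖ = √((x 0) ^ 2 + ((x 1) ^ 2 + (x 2) ^ 2)) := by
    intro x
    rw [EuclideanSpace.norm_eq, Fin.sum_univ_three]
    simp [add_assoc]
  have e1 : ∫⁻ x in ball (0 : E3) 1, k (x 0 / ‖x‖) =
      ∫⁻ x : E3, Φ (x 0, (x 1) ^ 2 + (x 2) ^ 2) := by
    rw [← lintegral_indicator measurableSet_ball]
    congr 1
    ext x
    simp only [hΦdef, ← e0, indicator, mem_ball, dist_zero_right, mem_Iio, Pi.one_apply]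
    split_ifs <;> simp
  rw [e1, aux_cyl Φ hΦ]
  have e2 : ∀ t : ℝ, ∫⁻ p : ℝ × ℝ, Φ (t, p.1 ^ 2 + p.2 ^ 2) =
      ENNReal.ofReal (2 * π) * ∫⁻ ρ, ENNReal.ofReal ρ * Φ (t, ρ ^ 2) := by
    intro t
    rw [aux_pol2 (fun q => Φ (t, q)) (by fun_prop)]
    congr 1
    rw [← lintegral_indicator measurableSet_Ioi]
    congr 1
    ext ρ
    simp only [indicator, mem_Ioi]
    split_ifs with h
    · rfl
    · rw [ENNReal.ofReal_of_nonpos (not_lt.1 h), zero_mul]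
  simp_rw [e2]
  rw [lintegral_const_mul _ (by fun_prop), mul_assoc]
  congr 1
  have e3 := lintegral_prod (μ := (volume : Measure ℝ)) (ν := (volume : Measure ℝ))
    (fun q : ℝ × ℝ => ENNReal.ofReal q.2 * Φ (q.1, q.2 ^ 2)) (by fun_prop)
  simp only at e3
  rw [← e3, ← Measure.volume_eq_prod, ← lintegral_comp_polarCoord_symm, polarCoord_target]
  have e4 : ∀ p ∈ Ioi (0:ℝ) ×ˢ Ioo (-π) π, ENNReal.ofReal p.1 •
      (ENNReal.ofReal (polarCoord.symm p).2 *
        Φ ((polarCoord.symm p).1, (polarCoord.symm p).2 ^ 2)) =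
      (ENNReal.ofReal p.1 * (ENNReal.ofReal p.1 * (Iio (1:ℝ)).indicator 1 p.1)) *
        (ENNReal.ofReal (Real.sin p.2) * k (Real.cos p.2)) := by
    rintro ⟨R, θ⟩ ⟨hR, _⟩
    simp only [mem_Ioi] at hR
    have : R ^ 2 * Real.cos θ ^ 2 + R ^ 2 * Real.sin θ ^ 2 = R ^ 2 := by
      nlinarith [Real.sin_sq_add_cos_sq θ]
    simp only [polarCoord_symm_apply, hΦdef, smul_eq_mul, mul_pow, this, Real.sqrt_sq hR.le]
    rw [mul_div_cancel_left₀ _ hR.ne', ENNReal.ofReal_mul hR.le]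
    ring
  rw [setLIntegral_congr_fun (measurableSet_Ioi.prod measurableSet_Ioo) e4,
    Measure.volume_eq_prod, ← Measure.prod_restrict, lintegral_prod_mul
    (f := fun R : ℝ => ENNReal.ofReal R * (ENNReal.ofReal R * (Iio (1:ℝ)).indicator 1 R))
    (g := fun θ : ℝ => ENNReal.ofReal (Real.sin θ) * k (Real.cos θ)) (by fun_prop)
    (by fun_prop), aux_half]

lemma aux_iso (v w : E3) (h : ‖v‖ = ‖w‖) : ∃ e : E3 ≃ₗᵢ[ℝ] E3, e v = w :=
  ⟨_, Submodule.reflection_sub h⟩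

lemma aux_norm_e1 : ‖e1‖ = 1 := by simp [e1]

lemma aux_arch1 : ∃ C0 : ℝ≥0∞, ∀ (k : ℝ → ℝ≥0∞) (_ : Measurable k) (u : E3) (_ : ‖u‖ = 1),
    ∫⁻ x in ball (0 : E3) 1, k (⟪u, x⟫ / ‖x‖) = C0 * ∫⁻ z in Icc (-1:ℝ) 1, k z := by
  obtain ⟨C0, hC⟩ := aux_arch0
  refine ⟨C0, fun k hk u hu => ?_⟩
  rw [← hC k hk]
  obtain ⟨e, he⟩ := aux_iso u e1 (by rw [hu, aux_norm_e1])
  rw [← lintegral_indicator measurableSet_ball, ← lintegral_indicator measurableSet_ball,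
    ← e.measurePreserving.lintegral_comp
      (f := (ball (0:E3) 1).indicator fun x => k (x 0 / ‖x‖)) (Measurable.indicator (by fun_prop) measurableSet_ball)]
  congr 1
  ext x
  have h1 : (e x) 0 = ⟪u, x⟫ := by
    rw [← e.inner_map_map, he, e1, EuclideanSpace.inner_single_left]
    simp
  simp only [indicator, mem_ball, dist_zero_right, LinearIsometryEquiv.norm_map, h1]

lemma aux_arch (ν : Measure E3) [IsProbabilityMeasure ν] (hν : IsRadial ν)
    (g : ℝ × ℝ → ℝ≥0∞) (hg : Measurable g) (v : E3) :
    ∫⁻ w, g (‖w‖, ⟪w, v⟫) ∂ν =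
      ∫⁻ w, (2⁻¹ * ∫⁻ z in Icc (-1:ℝ) 1, g (‖w‖, ‖w‖ * ‖v‖ * z)) ∂ν := by
  by_cases hv : v = 0
  · subst hv
    simp only [inner_zero_right, norm_zero, mul_zero, zero_mul, lintegral_const,
      Measure.restrict_apply, MeasurableSet.univ, univ_inter, Real.volume_Icc]
    congr 1
    ext w
    norm_num
    rw [mul_comm (g _), ← mul_assoc, ENNReal.inv_mul_cancel (by norm_num) (by norm_num), one_mul]
  obtain ⟨C0, hC⟩ := aux_arch1
  have hB : volume (ball (0:E3) 1) = C0 * 2 := by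
    have := hC (fun _ => 1) (by fun_prop) e1 aux_norm_e1
    simp only [lintegral_const, Measure.restrict_apply, MeasurableSet.univ, univ_inter,
      Real.volume_Icc, one_mul] at this
    rw [this]
    norm_num
  have hB0 : volume (ball (0:E3) 1) ≠ 0 := (measure_ball_pos _ _ one_pos).ne'
  have hBt : volume (ball (0:E3) 1) ≠ ⊤ := measure_ball_lt_top.ne
  have hC2 : C0 = volume (ball (0:E3) 1) * 2⁻¹ := by
    rw [hB, mul_assoc, ENNReal.mul_inv_cancel (by norm_num) (by norm_num), mul_one]
  have s1 : ∫⁻ x in ball (0:E3) 1, ∫⁻ u, g (‖u‖, ‖v‖ * (⟪u, x⟫ / ‖x‖)) ∂ν =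
      volume (ball (0:E3) 1) * ∫⁻ w, g (‖w‖, ⟪w, v⟫) ∂ν := by
    have : ∀ᵐ x ∂((volume : Measure E3).restrict (ball (0:E3) 1)),
        ∫⁻ u, g (‖u‖, ‖v‖ * (⟪u, x⟫ / ‖x‖)) ∂ν = ∫⁻ w, g (‖w‖, ⟪w, v⟫) ∂ν := by
      have h0 : ∀ᵐ x ∂((volume : Measure E3).restrict (ball (0:E3) 1)), x ≠ 0 :=
        Measure.ae_ne _ 0
      filter_upwards [h0] with x hx
      have hx' : 0 < ‖x‖ := norm_pos_iff.2 hx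
      obtain ⟨e, he⟩ := aux_iso v ((‖v‖ / ‖x‖) • x) (by
        rw [norm_smul, norm_div, norm_norm, norm_norm, div_mul_cancel₀ _ hx'.ne'])
      conv_lhs => rw [← hν e]
      rw [lintegral_map (by fun_prop) e.continuous.measurable]
      congr 1
      ext u
      rw [← e.inner_map_map u v, he, inner_smul_right, e.norm_map]
      congr 2
      ring
    rw [lintegral_congr_ae this, setLIntegral_const, mul_comm]
  have s2 : ∀ u : E3, ∫⁻ x in ball (0:E3) 1, g (‖u‖, ‖v‖ * (⟪u, x⟫ / ‖x‖)) =
      volume (ball (0:E3) 1) * (2⁻¹ * ∫⁻ z in Icc (-1:ℝ) 1, g (‖u‖, ‖u‖ * ‖v‖ * z)) := by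
    intro u
    rw [← mul_assoc, ← hC2]
    by_cases hu : u = 0
    · subst hu
      rw [← hC (fun z => g (‖(0:E3)‖, ‖(0:E3)‖ * ‖v‖ * z)) (by fun_prop) e1 aux_norm_e1]
      simp
    · have hu' : 0 < ‖u‖ := norm_pos_iff.2 hu
      rw [← hC (fun z => g (‖u‖, ‖u‖ * ‖v‖ * z)) (by fun_prop) ((‖u‖)⁻¹ • u) (by
        rw [norm_smul, norm_inv, norm_norm, inv_mul_cancel₀ hu'.ne'])]
      congr 1
      ext x
      rw [real_inner_smul_left]
      congr 2
      field_simp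
  have s3 := lintegral_lintegral_swap (μ := (volume : Measure E3).restrict (ball (0:E3) 1))
    (ν := ν) (f := fun x u => g (‖u‖, ‖v‖ * (⟪u, x⟫ / ‖x‖)))
    (by unfold Function.uncurry; fun_prop)
  rw [s1] at s3
  simp_rw [s2] at s3
  rw [lintegral_const_mul _ (by fun_prop)] at s3
  exact (ENNReal.mul_right_inj hB0 hBt).1 s3

/-- squared positive part -/
def PP (x : ℝ) : ℝ := max x 0 ^ 2

lemma PP_hasDerivAt (x : ℝ) : HasDerivAt PP (2 * max x 0) x := by
  have key : ∀ y : ℝ, y ≠ 0 → HasDerivAt PP (2 * max y 0) y := by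
    intro y hy
    rcases lt_or_gt_of_ne hy with h | h
    · rw [max_eq_right h.le, mul_zero]
      refine (hasDerivAt_const y (0:ℝ)).congr_of_eventuallyEq ?_
      filter_upwards [Iio_mem_nhds h] with z hz
      simp [PP, max_eq_right (le_of_lt (mem_Iio.1 hz))]
    · rw [max_eq_left h.le]
      have := hasDerivAt_pow 2 y
      simp only [Nat.cast_ofNat, Nat.add_one_sub_one, pow_one] at this
      refine this.congr_of_eventuallyEq ?_
      filter_upwards [Ioi_mem_nhds h] with z hz
      simp [PP, max_eq_left (le_of_lt (mem_Ioi.1 hz))]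
  by_cases hx : x = 0
  · subst hx
    exact hasDerivAt_of_hasDerivAt_of_ne (f := PP) (g := fun y => 2 * max y 0) (x := 0) key
      (by unfold PP; fun_prop) (by fun_prop)
  · exact key x hx

lemma PP_continuous : Continuous PP := by unfold PP; fun_prop

lemma aux_shell (A B : ℝ) (hA : 0 < A) (hB : 0 < B) (g G : ℝ → ℝ) (hg : ∀ x > 0, 0 ≤ g x)
    (hG : Continuous G) (hd : ∀ x > 0, HasDerivAt G (x * g x) x) :
    ∫⁻ z in Icc (-1:ℝ) 1, ENNReal.ofReal (g (√(A ^ 2 + B ^ 2 + 2 * A * B * z))) =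
      ENNReal.ofReal ((G (A + B) - G |A - B|) / (A * B)) := by
  have hAB : 0 < A * B := mul_pos hA hB
  have hQ : ∀ z ∈ Ioo (-1:ℝ) 1, 0 < A ^ 2 + B ^ 2 + 2 * A * B * z := by
    intro z hz
    nlinarith [sq_nonneg (A - B), mul_pos hAB (by linarith [hz.1] : 0 < 1 + z)]
  set f : ℝ → ℝ := fun z => G (√(A ^ 2 + B ^ 2 + 2 * A * B * z)) / (A * B) with hf
  have hcont : ContinuousOn f (Icc (-1) 1) := by
    apply Continuous.continuousOn; fun_prop
  have hder : ∀ z ∈ Ioo (-1:ℝ) 1,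
      HasDerivAt f (g (√(A ^ 2 + B ^ 2 + 2 * A * B * z))) z := by
    intro z hz
    have h0 := hQ z hz
    have hs : 0 < √(A ^ 2 + B ^ 2 + 2 * A * B * z) := Real.sqrt_pos.2 h0
    have h1 : HasDerivAt (fun z : ℝ => A ^ 2 + B ^ 2 + 2 * A * B * z) (2 * A * B) z := by
      simpa using ((hasDerivAt_id z).const_mul (2 * A * B)).const_add (A ^ 2 + B ^ 2)
    have h2 := ((hd _ hs).comp z (h1.sqrt h0.ne')).div_const (A * B)
    refine h2.congr_deriv ?_
    generalize √(A ^ 2 + B ^ 2 + 2 * A * B * z) = x at hs ⊢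
    field_simp
  have hnn : ∀ z ∈ Ioo (-1:ℝ) 1, 0 ≤ g (√(A ^ 2 + B ^ 2 + 2 * A * B * z)) :=
    fun z hz => hg _ (Real.sqrt_pos.2 (hQ z hz))
  have hint := intervalIntegral.integrableOn_deriv_of_nonneg hcont hder hnn
  have hI := intervalIntegral.integral_eq_sub_of_hasDerivAt_of_le (by norm_num) hcont hder
    ((intervalIntegrable_iff_integrableOn_Ioc_of_le (by norm_num)).2 hint)
  rw [← setLIntegral_congr (Ioo_ae_eq_Icc (a := (-1:ℝ)) (b := 1)),
    ← ofReal_integral_eq_lintegral_ofReal (hint.mono_set Ioo_subset_Ioc_self)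
      ((ae_restrict_iff' measurableSet_Ioo).2 (ae_of_all _ hnn)),
    ← integral_Ioc_eq_integral_Ioo, ← intervalIntegral.integral_of_le (by norm_num), hI]
  congr 1
  simp only [hf]
  have q1 : A ^ 2 + B ^ 2 + 2 * A * B * 1 = (A + B) ^ 2 := by ring
  have q2 : A ^ 2 + B ^ 2 + 2 * A * B * (-1) = (A - B) ^ 2 := by ring
  rw [q1, q2, Real.sqrt_sq (by positivity), Real.sqrt_sq_eq_abs, sub_div]

lemma aux_half_const (c : ℝ≥0∞) : 2⁻¹ * ∫⁻ _ in Icc (-1:ℝ) 1, c = c := by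
  simp only [lintegral_const, Measure.restrict_apply, MeasurableSet.univ, univ_inter,
    Real.volume_Icc]
  norm_num
  rw [mul_comm c, ← mul_assoc, ENNReal.inv_mul_cancel (by norm_num) (by norm_num), one_mul]

lemma aux_newton (A B : ℝ) (hA : 0 ≤ A) (hB : 0 ≤ B) :
    2⁻¹ * ∫⁻ z in Icc (-1:ℝ) 1, (ENNReal.ofReal (√(A ^ 2 + B ^ 2 + 2 * A * B * z)))⁻¹ =
      (ENNReal.ofReal (max A B))⁻¹ := by
  rcases hA.eq_or_lt with rfl | hA
  · simp only [ne_eq, OfNat.ofNat_ne_zero, not_false_eq_true, zero_pow, zero_add, mul_zero,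
      zero_mul, add_zero, Real.sqrt_sq hB, max_eq_right hB]
    exact aux_half_const _
  rcases hB.eq_or_lt with rfl | hB
  · simp only [ne_eq, OfNat.ofNat_ne_zero, not_false_eq_true, zero_pow, zero_add, mul_zero,
      zero_mul, add_zero, Real.sqrt_sq hA.le, max_eq_left hA.le]
    exact aux_half_const _
  have hAB : 0 < A * B := mul_pos hA hB
  have h := aux_shell A B hA hB (fun x => x⁻¹) id (fun x hx => by positivity) continuous_id
    (fun x hx => by rw [mul_inv_cancel₀ hx.ne']; exact hasDerivAt_id x)
  have h2 : ∫⁻ z in Icc (-1:ℝ) 1, (ENNReal.ofReal (√(A ^ 2 + B ^ 2 + 2 * A * B * z)))⁻¹ =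
      ∫⁻ z in Icc (-1:ℝ) 1, ENNReal.ofReal ((√(A ^ 2 + B ^ 2 + 2 * A * B * z))⁻¹) := by
    rw [← setLIntegral_congr (Ioo_ae_eq_Icc (a := (-1:ℝ)) (b := 1)),
      ← setLIntegral_congr (Ioo_ae_eq_Icc (a := (-1:ℝ)) (b := 1))]
    apply setLIntegral_congr_fun measurableSet_Ioo
    intro z hz
    have : 0 < A ^ 2 + B ^ 2 + 2 * A * B * z := by
      nlinarith [sq_nonneg (A - B), mul_pos hAB (by linarith [hz.1] : 0 < 1 + z)]
    simp only
    rw [ENNReal.ofReal_inv_of_pos (Real.sqrt_pos.2 this)]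
  rw [h2, h, ← ENNReal.ofReal_inv_of_pos (lt_max_of_lt_left hA)]
  have : (2:ℝ≥0∞)⁻¹ = ENNReal.ofReal 2⁻¹ := by
    rw [ENNReal.ofReal_inv_of_pos (by norm_num)]; norm_num
  rw [this, ← ENNReal.ofReal_mul (by norm_num)]
  congr 1
  simp only [id]
  rcases le_total A B with hab | hab
  · rw [max_eq_right hab, abs_of_nonpos (by linarith)]
    field_simp; ring
  · rw [max_eq_left hab, abs_of_nonneg (by linarith)]
    field_simp; ring

/-- averaged kernel -/
def II (r s : ℝ) : ℝ≥0∞ :=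
  2⁻¹ * ∫⁻ z in Icc (-1:ℝ) 1, (ENNReal.ofReal (max r (√(1 ^ 2 + s ^ 2 + 2 * 1 * s * z))))⁻¹

lemma II_exp (r s : ℝ) (hr : 0 < r) (hs : 0 < s) :
    II r s = ENNReal.ofReal (1 - (PP (r + s - 1) - PP (s - r - 1) - PP (r - s - 1)) / (4 * r * s)) := by
  have h := aux_shell 1 s one_pos hs (fun x => (max r x)⁻¹) (fun x => x + PP (r - x) / (2 * r))
    (fun x hx => by positivity) (by have := PP_continuous; fun_prop)
    (fun x hx => by
      have h1 := (((PP_hasDerivAt (r - x)).comp x ((hasDerivAt_id x).const_sub r)).div_const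
        (2 * r))
      refine ((hasDerivAt_id x).add h1).congr_deriv ?_
      rcases le_total r x with hab | hab
      · rw [max_eq_right hab, max_eq_right (by linarith)]
        field_simp; ring
      · rw [max_eq_left hab, max_eq_left (by linarith)]
        field_simp; ring)
  have : (2:ℝ≥0∞)⁻¹ = ENNReal.ofReal 2⁻¹ := by
    rw [ENNReal.ofReal_inv_of_pos (by norm_num)]; norm_num
  simp_rw [ENNReal.ofReal_inv_of_pos (lt_max_of_lt_left hr)] at h
  rw [II, h, this, ← ENNReal.ofReal_mul (by norm_num)]
  congr 1
  simp only [PP]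
  rcases le_total s 1 with h1 | h1
  · rw [abs_of_nonneg (by linarith), max_eq_right (by linarith : s - r - 1 ≤ 0)]
    have e1 : r - (1 + s) = r - s - 1 := by ring
    have e2 : r - (1 - s) = r + s - 1 := by ring
    rw [e1, e2]
    field_simp; ring
  · rw [abs_of_nonpos (by linarith), max_eq_left (by linarith : 0 ≤ r + s - 1)]
    have e1 : r - (1 + s) = r - s - 1 := by ring
    rw [e1]
    rcases le_total (s - r - 1) 0 with h2 | h2
    · rw [max_eq_right h2, max_eq_left (by linarith : 0 ≤ r - -(1 - s))]
      field_simp; ring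
    · rw [max_eq_left h2, max_eq_right (by linarith : r - -(1 - s) ≤ 0)]
      field_simp; ring

lemma II_zero_left (s : ℝ) (hs : 0 ≤ s) : II 0 s = (ENNReal.ofReal (max 1 s))⁻¹ := by
  rw [← aux_newton 1 s zero_le_one hs, II]
  simp only [max_eq_right (Real.sqrt_nonneg _)]

lemma II_zero_right (r : ℝ) : II r 0 = (ENNReal.ofReal (max r 1))⁻¹ := by
  rw [II]
  simp only [mul_zero, zero_mul, add_zero, ne_eq, OfNat.ofNat_ne_zero, not_false_eq_true,
    zero_pow, one_pow, Real.sqrt_one]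
  exact aux_half_const _

lemma II_symm (r s : ℝ) (hr : 0 ≤ r) (hs : 0 ≤ s) : II r s = II s r := by
  rcases hr.eq_or_lt with rfl | hr
  · rw [II_zero_left s hs, II_zero_right, max_comm]
  rcases hs.eq_or_lt with rfl | hs
  · rw [II_zero_left r hr.le, II_zero_right, max_comm]
  rw [II_exp r s hr hs, II_exp s r hs hr]
  congr 1
  have e : r + s - 1 = s + r - 1 := by ring
  rw [e]
  ring

lemma II_anti (r r' s : ℝ) (h : r ≤ r') : II r' s ≤ II r s := by
  unfold II
  gcongr

lemma II_le_one (r s : ℝ) (hr : 0 ≤ r) (hs : 0 ≤ s) : II r s ≤ 1 := by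
  refine (II_anti 0 r s hr).trans ?_
  rw [II_zero_left s hs, ENNReal.inv_le_one]
  rw [← ENNReal.ofReal_one]
  exact ENNReal.ofReal_le_ofReal (le_max_left _ _)

lemma II_mul_mono (r r' s : ℝ) (hr : 0 < r) (h : r ≤ r') :
    ENNReal.ofReal r * II r s ≤ ENNReal.ofReal r' * II r' s := by
  unfold II
  rw [mul_left_comm, mul_left_comm (ENNReal.ofReal r')]
  gcongr 2⁻¹ * ?_
  rw [← lintegral_const_mul _ (by fun_prop), ← lintegral_const_mul _ (by fun_prop)]
  apply lintegral_mono
  intro z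
  simp only
  set x := √(1 ^ 2 + s ^ 2 + 2 * 1 * s * z)
  have hr' : 0 < r' := hr.trans_le h
  rw [← ENNReal.ofReal_inv_of_pos (lt_max_of_lt_left hr),
    ← ENNReal.ofReal_inv_of_pos (lt_max_of_lt_left hr'), ← ENNReal.ofReal_mul hr.le,
    ← ENNReal.ofReal_mul hr'.le]
  apply ENNReal.ofReal_le_ofReal
  rw [← div_eq_mul_inv, ← div_eq_mul_inv,
    div_le_div_iff₀ (lt_max_of_lt_left hr) (lt_max_of_lt_left hr')]
  rcases le_total r x with h1 | h1
  · rw [max_eq_right h1]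
    rcases le_total r' x with h2 | h2
    · rw [max_eq_right h2]; nlinarith
    · rw [max_eq_left h2]; nlinarith
  · rw [max_eq_left h1, max_eq_left (h1.trans h)]; linarith

lemma II_measurable : Measurable (fun q : ℝ × ℝ => II q.1 q.2) := by
  unfold II
  fun_prop

/-- real version -/
def ff (r s : ℝ) : ℝ := (II r s).toReal

lemma ff_measurable : Measurable (fun q : ℝ × ℝ => ff q.1 q.2) :=
  II_measurable.ennreal_toReal

lemma II_ne_top (r s : ℝ) (hr : 0 ≤ r) (hs : 0 ≤ s) : II r s ≠ ⊤ :=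
  ((II_le_one r s hr hs).trans_lt ENNReal.one_lt_top).ne

lemma ff_nonneg (r s : ℝ) : 0 ≤ ff r s := ENNReal.toReal_nonneg

lemma ff_le_one (r s : ℝ) (hr : 0 ≤ r) (hs : 0 ≤ s) : ff r s ≤ 1 :=
  ENNReal.toReal_le_of_le_ofReal zero_le_one (by simpa using II_le_one r s hr hs)

lemma ff_symm (r s : ℝ) (hr : 0 ≤ r) (hs : 0 ≤ s) : ff r s = ff s r := by
  rw [ff, II_symm r s hr hs, ff]

lemma ff_anti (r r' s : ℝ) (hr : 0 ≤ r) (hs : 0 ≤ s) (h : r ≤ r') : ff r' s ≤ ff r s :=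
  ENNReal.toReal_mono (II_ne_top r s hr hs) (II_anti r r' s h)

lemma ff_mul_mono (r r' s : ℝ) (hr : 0 < r) (hs : 0 ≤ s) (h : r ≤ r') :
    r * ff r s ≤ r' * ff r' s := by
  have h1 := ENNReal.toReal_mono
    (ENNReal.mul_ne_top ENNReal.ofReal_ne_top (II_ne_top r' s (hr.le.trans h) hs))
    (II_mul_mono r r' s hr h)
  rwa [ENNReal.toReal_mul, ENNReal.toReal_mul, ENNReal.toReal_ofReal hr.le,
    ENNReal.toReal_ofReal (hr.le.trans h)] at h1

lemma ff_exp (r s : ℝ) (hr : 0 < r) (hs : 0 < s) :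
    ff r s = 1 - (PP (r + s - 1) - PP (s - r - 1) - PP (r - s - 1)) / (4 * r * s) := by
  rw [ff, II_exp r s hr hs, ENNReal.toReal_ofReal]
  rw [sub_nonneg, div_le_one (by positivity)]
  simp only [PP]
  rcases le_total (r + s - 1) 0 with h0 | h0
  · rw [max_eq_right h0]
    have := mul_pos hr hs
    nlinarith [sq_nonneg (max (s - r - 1) 0), sq_nonneg (max (r - s - 1) 0)]
  rw [max_eq_left h0]
  rcases le_total (s - r - 1) 0 with h1 | h1
  · rw [max_eq_right h1]
    rcases le_total (r - s - 1) 0 with h2 | h2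
    · rw [max_eq_right h2]
      nlinarith [mul_nonneg (neg_nonneg.2 h1) (neg_nonneg.2 h2)]
    · rw [max_eq_left h2]; nlinarith
  · rw [max_eq_left h1, max_eq_right (by linarith : r - s - 1 ≤ 0)]; nlinarith

lemma aux_DD (μ ν : Measure E3) [IsProbabilityMeasure μ] [IsProbabilityMeasure ν]
    (hμ : IsRadial μ) (hν : IsRadial ν) (a b : ℝ) (ha : 0 < a) (hb : 0 < b) :
    ∫⁻ x, ∫⁻ y, coul x y ∂(dilate ν e1 b) ∂(dilate μ 0 a) =
      ∫⁻ u, ∫⁻ w, II (‖u‖ / a) (‖w‖ / b) ∂ν ∂μ := by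
  have hcoul : Measurable (fun q : E3 × E3 => coul q.1 q.2) := by unfold coul; fun_prop
  have m1 : Measurable (fun u : E3 => (0:E3) + a⁻¹ • u) := by fun_prop
  have m2 : Measurable (fun u : E3 => e1 + b⁻¹ • u) := by fun_prop
  have hin : ∀ x : E3, ∫⁻ y, coul x y ∂(dilate ν e1 b) =
      ∫⁻ w, coul x (e1 + b⁻¹ • w) ∂ν := by
    intro x
    rw [dilate, lintegral_map (by fun_prop) m2]
  simp_rw [hin]
  rw [dilate, lintegral_map (by fun_prop) m1]
  rw [lintegral_lintegral_swap (by unfold Function.uncurry; fun_prop)]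
  -- Newton for `μ`
  have n1 : ∀ w : E3, ∫⁻ u, coul (0 + a⁻¹ • u) (e1 + b⁻¹ • w) ∂μ =
      ∫⁻ u, (ENNReal.ofReal (max (‖u‖ / a) ‖e1 + b⁻¹ • w‖))⁻¹ ∂μ := by
    intro w
    set x := e1 + b⁻¹ • w
    have h := aux_arch μ hμ
      (fun q => (ENNReal.ofReal (√((q.1 / a) ^ 2 + ‖x‖ ^ 2 + 2 * (q.2 / a))))⁻¹)
      (by fun_prop) (-x)
    have e1 : ∀ u : E3, coul (0 + a⁻¹ • u) x =
        (ENNReal.ofReal (√((‖u‖ / a) ^ 2 + ‖x‖ ^ 2 + 2 * (⟪u, -x⟫ / a))))⁻¹ := by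
      intro u
      unfold coul
      congr 2
      rw [eq_comm, Real.sqrt_eq_iff_eq_sq _ (norm_nonneg _)]
      · rw [zero_add, norm_sub_sq_real, real_inner_smul_left, norm_smul, inner_neg_right,
          norm_inv, Real.norm_of_nonneg ha.le]
        field_simp; ring
      · have := norm_sub_sq_real (a⁻¹ • u) x
        rw [real_inner_smul_left, norm_smul, norm_inv, Real.norm_of_nonneg ha.le] at this
        have h3 : (‖u‖ / a) ^ 2 + ‖x‖ ^ 2 + 2 * (⟪u, -x⟫ / a) = ‖a⁻¹ • u - x‖ ^ 2 := by
          rw [this, inner_neg_right]; field_simp; ring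
        rw [h3]; positivity
    simp_rw [e1]
    simp only at h
    rw [h]
    congr 1
    ext u
    rw [← aux_newton _ _ (by positivity) (by positivity), norm_neg]
    congr 2
    ext z
    congr 4
    field_simp
  simp_rw [n1]
  rw [lintegral_lintegral_swap (by unfold Function.uncurry; fun_prop)]
  congr 1
  ext u
  have h := aux_arch ν hν
      (fun q => (ENNReal.ofReal (max (‖u‖ / a)
        (√(1 ^ 2 + (q.1 / b) ^ 2 + 2 * (q.2 / b)))))⁻¹) (by fun_prop) e1
  simp only at h
  have e2 : ∀ w : E3, ‖e1 + b⁻¹ • w‖ = √(1 ^ 2 + (‖w‖ / b) ^ 2 + 2 * (⟪w, e1⟫ / b)) := by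
    intro w
    have h3 : 1 ^ 2 + (‖w‖ / b) ^ 2 + 2 * (⟪w, e1⟫ / b) = ‖e1 + b⁻¹ • w‖ ^ 2 := by
      rw [norm_add_sq_real, real_inner_smul_right, norm_smul, real_inner_comm, aux_norm_e1,
        norm_inv, Real.norm_of_nonneg hb.le]
      field_simp; ring
    rw [h3, Real.sqrt_sq (norm_nonneg _)]
  simp_rw [e2]
  rw [h]
  congr 1
  ext w
  rw [II, aux_norm_e1]
  congr 2
  ext z
  congr 5
  field_simp

/-- pointwise version of `Phi` -/
def hh (U W : ℝ) (p : ℝ × ℝ) : ℝ :=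
  if 0 < p.1 ∧ 0 < p.2 then p.1 ^ 3 * p.2 ^ 3 * (1 - ff (U / p.1) (W / p.2)) else 0

lemma aux_meas2 (a b : ℝ) : Measurable (fun q : E3 × E3 => II (‖q.1‖ / a) (‖q.2‖ / b)) := by
  unfold II
  fun_prop

lemma hh_measurable (p : ℝ × ℝ) : Measurable (fun q : E3 × E3 => hh ‖q.1‖ ‖q.2‖ p) := by
  unfold hh
  split_ifs
  · have := (aux_meas2 p.1 p.2).ennreal_toReal
    unfold ff
    fun_prop
  · fun_prop

lemma hh_bound (U W : ℝ) (hU : 0 ≤ U) (hW : 0 ≤ W) (p : ℝ × ℝ) :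
    |hh U W p| ≤ max p.1 0 ^ 3 * max p.2 0 ^ 3 := by
  unfold hh
  split_ifs with h
  · have h1 := ff_nonneg (U / p.1) (W / p.2)
    have h2 := ff_le_one (U / p.1) (W / p.2) (div_nonneg hU h.1.le) (div_nonneg hW h.2.le)
    have h3 : 0 < p.1 ^ 3 * p.2 ^ 3 := mul_pos (pow_pos h.1 3) (pow_pos h.2 3)
    rw [max_eq_left h.1.le, max_eq_left h.2.le, abs_of_nonneg (by nlinarith)]
    nlinarith
  · rw [abs_zero]; positivity

lemma hh_integrable (μ ν : Measure E3) [IsProbabilityMeasure μ] [IsProbabilityMeasure ν]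
    (p : ℝ × ℝ) : Integrable (fun q : E3 × E3 => hh ‖q.1‖ ‖q.2‖ p) (μ.prod ν) := by
  refine Integrable.of_bound (hh_measurable p).aestronglyMeasurable
    (max p.1 0 ^ 3 * max p.2 0 ^ 3) (ae_of_all _ fun q => ?_)
  exact hh_bound _ _ (norm_nonneg _) (norm_nonneg _) p

lemma Phi_eq (μ ν : Measure E3) [IsProbabilityMeasure μ] [IsProbabilityMeasure ν]
    (hμ : IsRadial μ) (hν : IsRadial ν) (p : ℝ × ℝ) :
    Phi μ ν p.1 p.2 = ∫ q, hh ‖q.1‖ ‖q.2‖ p ∂(μ.prod ν) := by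
  unfold Phi hh
  split_ifs with h
  · have m : Measurable (fun q : E3 × E3 => II (‖q.1‖ / p.1) (‖q.2‖ / p.2)) :=
      aux_meas2 p.1 p.2
    have mf : Measurable (fun q : E3 × E3 => ff (‖q.1‖ / p.1) (‖q.2‖ / p.2)) :=
      m.ennreal_toReal
    have nn1 : ∀ u : E3, 0 ≤ ‖u‖ / p.1 := fun u => div_nonneg (norm_nonneg _) h.1.le
    have nn2 : ∀ u : E3, 0 ≤ ‖u‖ / p.2 := fun u => div_nonneg (norm_nonneg _) h.2.le
    have hi : Integrable (fun q : E3 × E3 => ff (‖q.1‖ / p.1) (‖q.2‖ / p.2)) (μ.prod ν) := by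
      refine Integrable.of_bound mf.aestronglyMeasurable 1 (ae_of_all _ fun q => ?_)
      rw [Real.norm_of_nonneg (ff_nonneg _ _)]
      exact ff_le_one _ _ (nn1 _) (nn2 _)
    have hD : 2 * Dr (dilate μ 0 p.1) (dilate ν e1 p.2) =
        ∫ q, ff (‖q.1‖ / p.1) (‖q.2‖ / p.2) ∂(μ.prod ν) := by
      rw [Dr, DD, aux_DD μ ν hμ hν _ _ h.1 h.2, ENNReal.toReal_mul]
      rw [← lintegral_prod (fun q : E3 × E3 => II (‖q.1‖ / p.1) (‖q.2‖ / p.2)) m.aemeasurable]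
      unfold ff
      rw [integral_toReal m.aemeasurable (ae_of_all _ fun q =>
        (II_le_one _ _ (nn1 _) (nn2 _)).trans_lt ENNReal.one_lt_top)]
      simp
    rw [hD, integral_const_mul, integral_sub (integrable_const _) hi]
    simp
  · simp

lemma aux_onedim (x y α β : ℝ) (hx : 0 < x) (hxy : x ≤ y) (h0 : 0 ≤ α) (h1 : β ≤ 1)
    (hab : α ≤ β) (hm : x * β ≤ y * α) :
    |y ^ 3 * (1 - β) - x ^ 3 * (1 - α)| ≤ 3 * y ^ 2 * (y - x) := by
  have hy : 0 < y := hx.trans_le hxy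
  have e : y ^ 3 * (1 - β) - x ^ 3 * (1 - α) = (y ^ 3 - x ^ 3) * (1 - α) - y ^ 3 * (β - α) := by
    ring
  have c1 : 0 ≤ y ^ 3 - x ^ 3 := sub_nonneg.2 (pow_le_pow_left₀ hx.le hxy 3)
  have c2 : y ^ 3 - x ^ 3 ≤ 3 * y ^ 2 * (y - x) := by
    have : 3 * y ^ 2 * (y - x) - (y ^ 3 - x ^ 3) = (y - x) ^ 2 * (2 * y + x) := by ring
    nlinarith [mul_nonneg (sq_nonneg (y - x)) (by linarith : 0 ≤ 2 * y + x)]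
  have c3 : 0 ≤ y ^ 3 * (β - α) := mul_nonneg (by positivity) (by linarith)
  have c4 : y ^ 3 * (β - α) ≤ y ^ 2 * (y - x) := by
    have h5 : y * (β - α) ≤ y - x := by nlinarith
    calc y ^ 3 * (β - α) = y ^ 2 * (y * (β - α)) := by ring
      _ ≤ _ := by gcongr
  have c5 : 0 ≤ y ^ 2 * (y - x) := mul_nonneg (by positivity) (by linarith)
  rw [e, abs_le]
  constructor
  · nlinarith [mul_nonneg c1 (by linarith : 0 ≤ 1 - α)]
  · nlinarith [mul_nonneg c1 h0]

lemma hh_swap (U W : ℝ) (hU : 0 ≤ U) (hW : 0 ≤ W) (p : ℝ × ℝ) :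
    hh U W p = hh W U (p.2, p.1) := by
  unfold hh
  simp only
  by_cases h : 0 < p.1 ∧ 0 < p.2
  · rw [if_pos h, if_pos h.symm, ff_symm _ _ (div_nonneg hU h.1.le) (div_nonneg hW h.2.le)]
    ring
  · rw [if_neg h, if_neg (fun h' => h h'.symm)]

lemma hh_lip1' (U W : ℝ) (hU : 0 ≤ U) (hW : 0 ≤ W) (x y b : ℝ) (hx : 0 < x) (hxy : x ≤ y)
    (hb : 0 < b) : |hh U W (y, b) - hh U W (x, b)| ≤ 3 * y ^ 2 * b ^ 3 * (y - x) := by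
  have hy : 0 < y := hx.trans_le hxy
  unfold hh
  simp only [hx, hy, hb, and_self, if_true]
  have h := aux_onedim x y (ff (U / x) (W / b)) (ff (U / y) (W / b)) hx hxy (ff_nonneg _ _)
    (ff_le_one _ _ (by positivity) (by positivity))
    (ff_anti _ _ _ (by positivity) (by positivity) (by gcongr)) (by
      rcases hU.eq_or_lt with rfl | hU
      · simp only [zero_div]
        exact mul_le_mul_of_nonneg_right hxy (ff_nonneg _ _)
      · have := ff_mul_mono (U / y) (U / x) (W / b) (by positivity) (by positivity) (by gcongr)
        have h2 : x * y / U * (U / y * ff (U / y) (W / b)) ≤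
          x * y / U * (U / x * ff (U / x) (W / b)) := by gcongr
        have e1 : x * y / U * (U / y * ff (U / y) (W / b)) = x * ff (U / y) (W / b) := by
          field_simp
        have e2 : x * y / U * (U / x * ff (U / x) (W / b)) = y * ff (U / x) (W / b) := by
          field_simp
        rwa [e1, e2] at h2)
  have e : y ^ 3 * b ^ 3 * (1 - ff (U / y) (W / b)) - x ^ 3 * b ^ 3 * (1 - ff (U / x) (W / b)) =
    b ^ 3 * (y ^ 3 * (1 - ff (U / y) (W / b)) - x ^ 3 * (1 - ff (U / x) (W / b))) := by ring
  rw [e, abs_mul, abs_of_pos (by positivity)]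
  calc _ ≤ b ^ 3 * (3 * y ^ 2 * (y - x)) := by gcongr
    _ = _ := by ring

/-- weight -/
def MM (p q : ℝ × ℝ) : ℝ :=
  max (max p.1 q.1) 0 ^ 2 * max (max p.2 q.2) 0 ^ 3 +
    max (max p.1 q.1) 0 ^ 3 * max (max p.2 q.2) 0 ^ 2

lemma hh_lip1 (U W : ℝ) (hU : 0 ≤ U) (hW : 0 ≤ W) (x y b : ℝ) (hb : 0 < b) :
    |hh U W (x, b) - hh U W (y, b)| ≤ 3 * max (max x y) 0 ^ 2 * b ^ 3 * |x - y| := by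
  wlog hxy : x ≤ y generalizing x y
  · have := this y x (le_of_not_ge hxy)
    rwa [abs_sub_comm, max_comm y x, abs_sub_comm y x] at this
  rw [max_eq_right hxy, abs_of_nonpos (by linarith : x - y ≤ 0)]
  rcases le_or_gt y 0 with hy | hy
  · have : 0 ≤ 3 * max y 0 ^ 2 * b ^ 3 * -(x - y) :=
      mul_nonneg (by positivity) (by linarith)
    unfold hh
    simpa [not_lt.2 hy, not_lt.2 (hxy.trans hy)] using this
  rw [max_eq_left hy.le]
  rcases le_or_gt x 0 with hx | hx
  · have h1 : hh U W (x, b) = 0 := by unfold hh; simp [not_lt.2 hx]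
    have h2 := hh_bound U W hU hW (y, b)
    simp only [max_eq_left hy.le, max_eq_left hb.le] at h2
    rw [h1, zero_sub, abs_neg]
    refine h2.trans ?_
    have : y ≤ -(x - y) := by linarith
    calc y ^ 3 * b ^ 3 = 1 * y ^ 2 * b ^ 3 * y := by ring
      _ ≤ 3 * y ^ 2 * b ^ 3 * -(x - y) := by gcongr; norm_num
  · have := hh_lip1' U W hU hW x y b hx hxy hb
    rw [abs_sub_comm]
    linarith

lemma hh_lip (U W : ℝ) (hU : 0 ≤ U) (hW : 0 ≤ W) (p q : ℝ × ℝ) :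
    |hh U W p - hh U W q| ≤ 3 * MM p q * ‖p - q‖ := by
  obtain ⟨a, b⟩ := p
  obtain ⟨c, d⟩ := q
  have n1 : |a - c| ≤ ‖((a, b) - (c, d) : ℝ × ℝ)‖ := norm_fst_le ((a, b) - (c, d) : ℝ × ℝ)
  have n2 : |b - d| ≤ ‖((a, b) - (c, d) : ℝ × ℝ)‖ := norm_snd_le ((a, b) - (c, d) : ℝ × ℝ)
  set N := ‖((a, b) - (c, d) : ℝ × ℝ)‖
  simp only [MM]
  set A := max (max a c) 0 with hA
  set B := max (max b d) 0 with hB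
  have hA0 : 0 ≤ A := le_max_right _ _
  have hB0 : 0 ≤ B := le_max_right _ _
  have hN : 0 ≤ N := norm_nonneg _
  have haA : a ≤ A := (le_max_left _ _).trans (le_max_left _ _)
  have hcA : c ≤ A := (le_max_right _ _).trans (le_max_left _ _)
  have hbB : b ≤ B := (le_max_left _ _).trans (le_max_left _ _)
  have hdB : d ≤ B := (le_max_right _ _).trans (le_max_left _ _)
  have step1 : ∀ t, t ≤ B → 0 < t → |hh U W (a, t) - hh U W (c, t)| ≤ 3 * A ^ 2 * B ^ 3 * N := by
    intro t ht ht0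
    refine (hh_lip1 U W hU hW a c t ht0).trans ?_
    gcongr
  have step2 : ∀ t, t ≤ A → 0 < t → |hh U W (t, b) - hh U W (t, d)| ≤ 3 * A ^ 3 * B ^ 2 * N := by
    intro t ht ht0
    rw [hh_swap U W hU hW, hh_swap U W hU hW (t, d)]
    refine (hh_lip1 W U hW hU b d t ht0).trans ?_
    calc _ ≤ 3 * B ^ 2 * A ^ 3 * N := by gcongr
      _ = _ := by ring
  have p1 : 0 ≤ 3 * A ^ 2 * B ^ 3 * N := by positivity
  have p2 : 0 ≤ 3 * A ^ 3 * B ^ 2 * N := by positivity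
  have z1 : ∀ x y : ℝ, x ≤ 0 → hh U W (x, y) = 0 := by
    intro x y h; unfold hh; simp [not_lt.2 h]
  have z2 : ∀ x y : ℝ, y ≤ 0 → hh U W (x, y) = 0 := by
    intro x y h; unfold hh; simp [not_lt.2 h]
  suffices h : |hh U W (a, b) - hh U W (c, d)| ≤ 3 * A ^ 2 * B ^ 3 * N + 3 * A ^ 3 * B ^ 2 * N by
    linarith
  rcases le_or_gt b 0 with hb | hb
  · rcases le_or_gt c 0 with hc | hc
    · rw [z2 a b hb, z1 c d hc, sub_zero, abs_zero]; linarith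
    · have := step2 c hcA hc
      rw [z2 c b hb] at this
      rw [z2 a b hb]; linarith
  · rcases le_or_gt c 0 with hc | hc
    · have := step1 b hbB hb
      rw [z1 c b hc] at this
      rw [z1 c d hc]; linarith
    · have h1 := step1 b hbB hb
      have h2 := step2 c hcA hc
      have := abs_sub_le (hh U W (a, b)) (hh U W (c, b)) (hh U W (c, d))
      linarith

lemma Phi_lip (μ ν : Measure E3) [IsProbabilityMeasure μ] [IsProbabilityMeasure ν]
    (hμ : IsRadial μ) (hν : IsRadial ν) (p q : ℝ × ℝ) :
    |Phi μ ν p.1 p.2 - Phi μ ν q.1 q.2| ≤ 3 * MM p q * ‖p - q‖ := by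
  rw [Phi_eq μ ν hμ hν, Phi_eq μ ν hμ hν, ← integral_sub (hh_integrable _ _ _)
    (hh_integrable _ _ _), ← Real.norm_eq_abs]
  refine (norm_integral_le_of_norm_le_const (ae_of_all _ fun z =>
    hh_lip ‖z.1‖ ‖z.2‖ (norm_nonneg _) (norm_nonneg _) p q)).trans ?_
  simp

lemma Psi_lip (μ ν : Measure E3) [IsProbabilityMeasure μ] [IsProbabilityMeasure ν]
    (hμ : IsRadial μ) (hν : IsRadial ν) (p q : ℝ × ℝ) :
    |Psi μ ν p.1 p.2 - Psi μ ν q.1 q.2| ≤ 9 * MM p q * ‖p - q‖ := by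
  have h1 := abs_le.1 (Phi_lip μ ν hμ hν p q)
  have h2 := abs_le.1 (Phi_lip ν μ hν hμ p q)
  have h3 := abs_le.1 (Phi_lip ν ν hν hν p q)
  unfold Psi
  rw [abs_le]
  constructor <;> linarith [h1.1, h1.2, h2.1, h2.2, h3.1, h3.2]

lemma MM_le (R : ℝ) (p q : ℝ × ℝ) (hp : ‖p‖ ≤ R) (hq : ‖q‖ ≤ R) : MM p q ≤ 2 * R ^ 5 := by
  have hR : 0 ≤ R := (norm_nonneg _).trans hp
  have b1 : max (max p.1 q.1) 0 ≤ R := max_le (max_le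
    ((le_abs_self _).trans ((norm_fst_le p).trans hp))
    ((le_abs_self _).trans ((norm_fst_le q).trans hq))) hR
  have b2 : max (max p.2 q.2) 0 ≤ R := max_le (max_le
    ((le_abs_self _).trans ((norm_snd_le p).trans hp))
    ((le_abs_self _).trans ((norm_snd_le q).trans hq))) hR
  unfold MM
  calc _ ≤ R ^ 2 * R ^ 3 + R ^ 3 * R ^ 2 := by gcongr
    _ = _ := by ring

lemma Psi_lipOn (μ ν : Measure E3) [IsProbabilityMeasure μ] [IsProbabilityMeasure ν]
    (hμ : IsRadial μ) (hν : IsRadial ν) (R : ℝ) :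
    LipschitzOnWith (Real.toNNReal (18 * R ^ 5)) (fun q : ℝ × ℝ => Psi μ ν q.1 q.2)
      (ball 0 R) := by
  apply LipschitzOnWith.of_dist_le_mul
  intro p hp q hq
  rw [mem_ball_zero_iff] at hp hq
  have hR : 0 ≤ R := (norm_nonneg _).trans hp.le
  rw [Real.coe_toNNReal _ (by positivity), Real.dist_eq, dist_eq_norm]
  refine (Psi_lip μ ν hμ hν p q).trans ?_
  exact mul_le_mul_of_nonneg_right (by linarith [MM_le R p q hp.le hq.le]) (norm_nonneg _)

lemma Psi_ae_diff (μ ν : Measure E3) [IsProbabilityMeasure μ] [IsProbabilityMeasure ν]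
    (hμ : IsRadial μ) (hν : IsRadial ν) :
    ∀ᵐ p : ℝ × ℝ, DifferentiableAt ℝ (fun q : ℝ × ℝ => Psi μ ν q.1 q.2) p := by
  have h : ∀ n : ℕ, ∀ᵐ p : ℝ × ℝ, p ∈ ball (0 : ℝ × ℝ) n →
      DifferentiableWithinAt ℝ (fun q : ℝ × ℝ => Psi μ ν q.1 q.2) (ball 0 n) p :=
    fun n => (Psi_lipOn μ ν hμ hν n).ae_differentiableWithinAt_of_mem
  filter_upwards [ae_all_iff.2 h] with p hp
  obtain ⟨n, hn⟩ := exists_nat_gt ‖p‖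
  have hpn : p ∈ ball (0 : ℝ × ℝ) n := mem_ball_zero_iff.2 hn
  exact (hp n hpn).differentiableAt (isOpen_ball.mem_nhds hpn)

lemma Psi_fderiv_le (μ ν : Measure E3) [IsProbabilityMeasure μ] [IsProbabilityMeasure ν]
    (hμ : IsRadial μ) (hν : IsRadial ν) (p : ℝ × ℝ) :
    ‖fderiv ℝ (fun q : ℝ × ℝ => Psi μ ν q.1 q.2) p‖ ≤ 9 * MM p p := by
  have hMM : ∀ p q, 0 ≤ MM p q := fun p q => by unfold MM; positivity
  apply _root_.le_of_forall_pos_le_add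
  intro ε hε
  apply norm_fderiv_le_of_lip' ℝ (by have := hMM p p; positivity)
  have hc : Continuous (fun q : ℝ × ℝ => 9 * MM q p) := by unfold MM; fun_prop
  have : ∀ᶠ q in 𝓝 p, 9 * MM q p < 9 * MM p p + ε :=
    (hc.tendsto p).eventually_lt_const (by linarith)
  filter_upwards [this] with q hq
  rw [Real.norm_eq_abs]
  refine (Psi_lip μ ν hμ hν q p).trans ?_
  have hq' : 9 * MM q p < 9 * MM p p + ε := hq
  gcongr

/-- bracket -/
def QQ (U W : ℝ) (p : ℝ × ℝ) : ℝ :=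
  PP (U * p.2 + W * p.1 - p.1 * p.2) - PP (W * p.1 - U * p.2 - p.1 * p.2) -
    PP (U * p.2 - W * p.1 - p.1 * p.2)

lemma PP_div (x c : ℝ) (hc : 0 < c) : PP (x / c) = PP x / c ^ 2 := by
  unfold PP
  rw [← div_pow, ← max_div_div_right hc.le, zero_div]

lemma hh_exp (U W : ℝ) (hU : 0 < U) (hW : 0 < W) (p : ℝ × ℝ) :
    hh U W p = (4 * U * W)⁻¹ * (PP p.1 * PP p.2 * QQ U W p) := by
  unfold hh
  split_ifs with h
  · obtain ⟨ha, hb⟩ := h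
    obtain ⟨a, b⟩ := p
    simp only at ha hb ⊢
    rw [ff_exp _ _ (by positivity) (by positivity)]
    have hab : 0 < a * b := mul_pos ha hb
    have x1 : U / a + W / b - 1 = (U * b + W * a - a * b) / (a * b) := by field_simp
    have x2 : W / b - U / a - 1 = (W * a - U * b - a * b) / (a * b) := by field_simp
    have x3 : U / a - W / b - 1 = (U * b - W * a - a * b) / (a * b) := by field_simp
    have pa : PP a = a ^ 2 := by unfold PP; rw [max_eq_left ha.le]
    have pb : PP b = b ^ 2 := by unfold PP; rw [max_eq_left hb.le]
    rw [x1, x2, x3, PP_div _ _ hab, PP_div _ _ hab, PP_div _ _ hab, pa, pb, QQ]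
    simp only
    field_simp
    ring
  · have : PP p.1 * PP p.2 = 0 := by
      by_contra hne
      apply h
      constructor
      · by_contra h0
        apply hne
        simp [PP, max_eq_right (not_lt.1 h0)]
      · by_contra h0
        apply hne
        simp [PP, max_eq_right (not_lt.1 h0)]
    rw [this]; ring

/-- derivative of `X ↦ x U b + y W a - a b` -/
def LL (U W : ℝ) (p : ℝ × ℝ) : ℝ × ℝ →L[ℝ] ℝ :=
  (U - p.1) • ContinuousLinearMap.snd ℝ ℝ ℝ + (W - p.2) • ContinuousLinearMap.fst ℝ ℝ ℝ

lemma LL_has (U W : ℝ) (p : ℝ × ℝ) :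
    HasFDerivAt (fun p : ℝ × ℝ => U * p.2 + W * p.1 - p.1 * p.2) (LL U W p) p := by
  have h1 : HasFDerivAt (fun p : ℝ × ℝ => p.1) (ContinuousLinearMap.fst ℝ ℝ ℝ) p := hasFDerivAt_fst
  have h2 : HasFDerivAt (fun p : ℝ × ℝ => p.2) (ContinuousLinearMap.snd ℝ ℝ ℝ) p := hasFDerivAt_snd
  refine (((h2.const_mul U).add (h1.const_mul W)).sub (h1.mul h2)).congr_fderiv ?_
  ext <;> simp [LL]

/-- unnormalised derivative -/
def GG (U W : ℝ) (p : ℝ × ℝ) : ℝ × ℝ →L[ℝ] ℝ :=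
  (PP p.1 * PP p.2) •
    ((2 * max (U * p.2 + W * p.1 - p.1 * p.2) 0) • LL U W p -
      (2 * max (-U * p.2 + W * p.1 - p.1 * p.2) 0) • LL (-U) W p -
      (2 * max (U * p.2 + -W * p.1 - p.1 * p.2) 0) • LL U (-W) p) +
    QQ U W p • (PP p.1 • ((2 * max p.2 0) • ContinuousLinearMap.snd ℝ ℝ ℝ) +
      PP p.2 • ((2 * max p.1 0) • ContinuousLinearMap.fst ℝ ℝ ℝ))

lemma GG_has (U W : ℝ) (p : ℝ × ℝ) :
    HasFDerivAt (fun p : ℝ × ℝ => PP p.1 * PP p.2 * QQ U W p) (GG U W p) p := by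
  have h1 : HasFDerivAt (fun p : ℝ × ℝ => p.1) (ContinuousLinearMap.fst ℝ ℝ ℝ) p := hasFDerivAt_fst
  have h2 : HasFDerivAt (fun p : ℝ × ℝ => p.2) (ContinuousLinearMap.snd ℝ ℝ ℝ) p := hasFDerivAt_snd
  have k1 := (PP_hasDerivAt p.1).comp_hasFDerivAt p h1
  have k2 := (PP_hasDerivAt p.2).comp_hasFDerivAt p h2
  have q1 := (PP_hasDerivAt _).comp_hasFDerivAt p (LL_has U W p)
  have q2 := (PP_hasDerivAt _).comp_hasFDerivAt p (LL_has (-U) W p)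
  have q3 := (PP_hasDerivAt _).comp_hasFDerivAt p (LL_has U (-W) p)
  have hq := ((q1.sub q2).sub q3).congr_of_eventuallyEq (f₁ := QQ U W) (by
    refine Eventually.of_forall fun x => ?_
    simp only [QQ, Function.comp, Pi.sub_apply]
    congr 2
    · congr 1; ring_nf
    · ring_nf)
  exact (k1.mul k2).mul hq

lemma GG_cont : Continuous (fun z : (ℝ × ℝ) × (ℝ × ℝ) => GG z.1.1 z.1.2 z.2) := by
  have := PP_continuous
  unfold GG LL QQ
  fun_prop

/-- derivative of hh -/
def hD (U W : ℝ) (p : ℝ × ℝ) : ℝ × ℝ →L[ℝ] ℝ := (4 * U * W)⁻¹ • GG U W p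

lemma hD_has (U W : ℝ) (hU : 0 < U) (hW : 0 < W) (p : ℝ × ℝ) :
    HasFDerivAt (hh U W) (hD U W p) p := by
  have : hh U W = fun p => (4 * U * W)⁻¹ * (PP p.1 * PP p.2 * QQ U W p) :=
    funext (hh_exp U W hU hW)
  rw [this]
  exact (GG_has U W p).const_mul _

lemma hD_cont (U W : ℝ) : Continuous (hD U W) := by
  unfold hD
  have := GG_cont.comp (by fun_prop : Continuous fun p : ℝ × ℝ => ((U, W), p))
  exact this.const_smul ((4 * U * W)⁻¹ : ℝ)

lemma hD_meas (p : ℝ × ℝ) : StronglyMeasurable (fun q : E3 × E3 => hD ‖q.1‖ ‖q.2‖ p) := by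
  unfold hD
  have h1 := (GG_cont.comp
    (by fun_prop : Continuous fun q : E3 × E3 => ((‖q.1‖, ‖q.2‖), p))).stronglyMeasurable
  have h2 : StronglyMeasurable (fun q : E3 × E3 => (4 * ‖q.1‖ * ‖q.2‖)⁻¹) :=
    Measurable.stronglyMeasurable (by fun_prop)
  exact h2.smul h1

lemma hD_bound (U W : ℝ) (hU : 0 < U) (hW : 0 < W) (R : ℝ) (p : ℝ × ℝ) (hp : ‖p‖ < R) :
    ‖hD U W p‖ ≤ 6 * R ^ 5 := by
  have hR : 0 ≤ R := (norm_nonneg _).trans hp.le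
  refine (hD_has U W hU hW p).le_of_lip' (by positivity) ?_
  filter_upwards [isOpen_ball.mem_nhds (mem_ball_zero_iff.2 hp)] with q hq
  rw [mem_ball_zero_iff] at hq
  rw [Real.norm_eq_abs]
  refine (hh_lip U W hU.le hW.le q p).trans ?_
  exact mul_le_mul_of_nonneg_right (by linarith [MM_le R q p hq.le hp.le]) (norm_nonneg _)

lemma Phi_contDiff (μ ν : Measure E3) [IsProbabilityMeasure μ] [IsProbabilityMeasure ν]
    (hμ : IsRadial μ) (hν : IsRadial ν) (hμ0 : μ {0} = 0) (hν0 : ν {0} = 0) :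
    ContDiff ℝ 1 (fun q : ℝ × ℝ => Phi μ ν q.1 q.2) := by
  have ae1 : ∀ᵐ q ∂(μ.prod ν), 0 < ‖q.1‖ ∧ 0 < ‖q.2‖ := by
    have a1 : ∀ᵐ u ∂μ, 0 < ‖u‖ := by
      rw [ae_iff]; simpa using hμ0
    have a2 : ∀ᵐ u ∂ν, 0 < ‖u‖ := by
      rw [ae_iff]; simpa using hν0
    exact (Measure.quasiMeasurePreserving_fst.ae a1).and (Measure.quasiMeasurePreserving_snd.ae a2)
  rw [contDiff_one_iff_hasFDerivAt]
  simp_rw [Phi_eq μ ν hμ hν]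
  refine ⟨fun p => ∫ q, hD ‖q.1‖ ‖q.2‖ p ∂(μ.prod ν), ?_, ?_⟩
  · rw [continuous_iff_continuousAt]
    intro p
    refine continuousAt_of_dominated (bound := fun _ => 6 * (‖p‖ + 1) ^ 5)
      (Eventually.of_forall fun x => (hD_meas x).aestronglyMeasurable) ?_ (integrable_const _) ?_
    · filter_upwards [isOpen_ball.mem_nhds (mem_ball_zero_iff.2 (lt_add_one ‖p‖))] with x hx
      filter_upwards [ae1] with q hq
      exact hD_bound _ _ hq.1 hq.2 _ _ (mem_ball_zero_iff.1 hx)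
    · exact ae_of_all _ fun q => (hD_cont _ _).continuousAt
  · intro p
    refine hasFDerivAt_integral_of_dominated_of_fderiv_le
      (F := fun (x : ℝ × ℝ) (q : E3 × E3) => hh ‖q.1‖ ‖q.2‖ x)
      (F' := fun (x : ℝ × ℝ) (q : E3 × E3) => hD ‖q.1‖ ‖q.2‖ x) (bound := fun _ => 6 * (‖p‖ + 1) ^ 5)
      (isOpen_ball.mem_nhds (mem_ball_zero_iff.2 (lt_add_one ‖p‖)))
      (Eventually.of_forall fun x => (hh_measurable x).aestronglyMeasurable)
      (hh_integrable μ ν p) (hD_meas p).aestronglyMeasurable ?_ (integrable_const _) ?_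
    · filter_upwards [ae1] with q hq x hx
      exact hD_bound _ _ hq.1 hq.2 _ _ (mem_ball_zero_iff.1 hx)
    · filter_upwards [ae1] with q hq x _
      exact hD_has _ _ hq.1 hq.2 x


/-- **Regularity of `Ψ_{μν}`** (Lemma 2 of the paper): if `μ({0}) = 0` and `μ, ν` have finite
first moment, then `Ψ_{μν}` is locally Lipschitz on `[0,∞)²`, its almost-everywhere defined
gradient satisfies `|∇Ψ_{μν}(a,b)| ≤ C(a²b³ + a³b²)`, and `Ψ_{μν}` vanishes on the two axes.
If moreover `ν({0}) = 0`, then `Ψ_{μν}` is `C¹`. -/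
theorem Psi_regularity (μ ν : Measure E3) [IsProbabilityMeasure μ] [IsProbabilityMeasure ν]
    (hμrad : IsRadial μ) (hνrad : IsRadial ν) (hμ0 : μ {0} = 0)
    (hμ1 : (∫⁻ x, ENNReal.ofReal ‖x‖ ∂μ) < ⊤) (hν1 : (∫⁻ x, ENNReal.ofReal ‖x‖ ∂ν) < ⊤) :
    (∀ p ∈ Ici (0:ℝ) ×ˢ Ici (0:ℝ), ∃ K : NNReal, ∃ t ∈ 𝓝[Ici (0:ℝ) ×ˢ Ici (0:ℝ)] p,
      LipschitzOnWith K (fun q : ℝ × ℝ => Psi μ ν q.1 q.2) t) ∧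
    (∃ C : ℝ, ∀ᵐ p : ℝ × ℝ ∂(volume.restrict (Ici (0:ℝ) ×ˢ Ici (0:ℝ))),
      DifferentiableAt ℝ (fun q : ℝ × ℝ => Psi μ ν q.1 q.2) p ∧
      ‖fderiv ℝ (fun q : ℝ × ℝ => Psi μ ν q.1 q.2) p‖ ≤
        C * (p.1 ^ 2 * p.2 ^ 3 + p.1 ^ 3 * p.2 ^ 2)) ∧
    (∀ a : ℝ, Psi μ ν a 0 = 0 ∧ Psi μ ν 0 a = 0) ∧
    (ν {0} = 0 →
      ContDiffOn ℝ 1 (fun q : ℝ × ℝ => Psi μ ν q.1 q.2) (Ici 0 ×ˢ Ici 0)) := by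

  refine ⟨?_, ⟨9, ?_⟩, ?_, ?_⟩
  · intro p _
    exact ⟨_, ball 0 (‖p‖ + 1), mem_nhdsWithin_of_mem_nhds
      (isOpen_ball.mem_nhds (mem_ball_zero_iff.2 (lt_add_one ‖p‖))), Psi_lipOn μ ν hμrad hνrad _⟩
  · filter_upwards [ae_restrict_of_ae (Psi_ae_diff μ ν hμrad hνrad),
      ae_restrict_mem (measurableSet_Ici.prod measurableSet_Ici)] with p hp hmem
    refine ⟨hp, (Psi_fderiv_le μ ν hμrad hνrad p).trans (le_of_eq ?_)⟩
    have h1 : 0 ≤ p.1 := hmem.1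
    have h2 : 0 ≤ p.2 := hmem.2
    simp only [MM, max_self, max_eq_left h1, max_eq_left h2]
  · intro a
    constructor <;> simp [Psi, Phi]
  · intro hν0
    have h := ((Phi_contDiff μ ν hμrad hνrad hμ0 hν0).add
      (Phi_contDiff ν μ hνrad hμrad hν0 hμ0)).sub (Phi_contDiff ν ν hνrad hνrad hν0 hν0)
    exact h.contDiffOn
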